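/- arXiv:1404.7711 — 3 statements merged into one kernel-verified Lean document; each statement's English description precedes it below -/
import Mathlib

section
/- Let 0 < k < n and let 0 < ε < min(k/n, 1 − k/n). For every x ∈ [0,1]^n, C^{p}(x) evaluated at p = k/n − ε satisfies C^{k/n−ε}(x) − e^{−2nε²} ≤ C^{k,n}(x), and C^{k,n}(x) ≤ C^{k/n+ε}(x) + e^{−2nε²}, where C^{p} denotes the expected cost under independent failures with probability p and C^{k,n} denotes the expected cost in the constant-number-of-failures model. -/
open Finset MeasureTheory

/-- Coverage cost on the line `[0,1]` for placement `x` and active set `A`: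
the largest distance from a point of `[0,1]` to the closest active sensor
(`1` by convention if `A = ∅`). -/
noncomputable def cost0 {n : ℕ} (x : Fin n → ℝ) (A : Finset (Fin n)) : ℝ :=
  if A.Nonempty then ⨆ s : Set.Icc (0:ℝ) 1, ⨅ j : A, |s.1 - x j.1| else 1

/-- Probability that `A` is the active set, under independent failures with
probability `p`. -/
noncomputable def prob {n : ℕ} (p : ℝ) (A : Finset (Fin n)) : ℝ :=
  p ^ (n - A.card) * (1 - p) ^ A.card

/-- Expected coverage cost `C(x)` under independent failures with probability `p`. -/
noncomputable def expCost {n : ℕ} (p : ℝ) (x : Fin n → ℝ) : ℝ :=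
  ∑ A : Finset (Fin n), prob p A * cost0 x A

/-- The equispaced placement `x^eq`, whose `i`-th entry (`i = 0, …, n-1`) is
`(2i+1)/(2n)`. -/
noncomputable def xeq (n : ℕ) : Fin n → ℝ := fun i => (2 * (i : ℝ) + 1) / (2 * n)

/-- The `k`-th smallest element of the finite set `A` (0-based). -/
noncomputable def nth {n : ℕ} (A : Finset (Fin n)) (k : Fin A.card) : Fin n :=
  (A.orderIsoOfFin rfl k).1

/-- Coverage cost on the circle of circumference 1 for the active set `A`. -/
noncomputable def ccost0 {n : ℕ} (x : Fin n → ℝ) (A : Finset (Fin n)) : ℝ :=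
  if A.Nonempty then
    ⨆ s : Set.Icc (0:ℝ) 1, ⨅ j : A, min |s.1 - x j.1| (1 - |s.1 - x j.1|)
  else 1

/-- Expected circle coverage cost `C̃(x)`. -/
noncomputable def cExpCost {n : ℕ} (p : ℝ) (x : Fin n → ℝ) : ℝ :=
  ∑ A : Finset (Fin n), prob p A * ccost0 x A

/-- Harmonic number `H_m = ∑_{h=1}^m 1/h`. -/
noncomputable def H (m : ℕ) : ℝ := ∑ i ∈ Finset.range m, 1 / ((i : ℝ) + 1)

/-- Length of the longest run of consecutive indices of `{0, …, n-1}` not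
belonging to `A`. -/
noncomputable def longestRun {n : ℕ} (A : Finset (Fin n)) : ℕ :=
  sSup {r : ℕ | ∃ a : ℕ, a + r ≤ n ∧ ∀ i : Fin n, a ≤ i.1 → i.1 < a + r → i ∉ A}

/-- Expected cost in the Cortés (constant-number-of-failures) model where
exactly `k` sensors fail, uniformly at random. -/
noncomputable def cortesCost {n : ℕ} (k : ℕ) (x : Fin n → ℝ) : ℝ :=
  (n.choose k : ℝ)⁻¹ *
    ∑ A ∈ Finset.univ.filter (fun A : Finset (Fin n) => A.card = n - k), cost0 x A

/-- Expectation over the random uniform i.i.d. placement `x^rand ∈ [0,1]^n`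
of the expected cost `C(x^rand)`. -/
noncomputable def randExp (n : ℕ) (p : ℝ) : ℝ :=
  ∫ x in Set.univ.pi (fun _ : Fin n => Set.Icc (0:ℝ) 1), expCost p x

/-- `E[C_0(x^{rand,m})]`: expected coverage cost of `m` i.i.d. uniform sensors,
all active. -/
noncomputable def randCost0 (m : ℕ) : ℝ :=
  ∫ x in Set.univ.pi (fun _ : Fin m => Set.Icc (0:ℝ) 1), cost0 x Finset.univ

/-- `E[C^{k,n}(x^rand)]`: expectation over the random placement of the Cortés
model cost. -/
noncomputable def randCortes (n k : ℕ) : ℝ :=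
  ∫ x in Set.univ.pi (fun _ : Fin n => Set.Icc (0:ℝ) 1), cortesCost k x

open ProbabilityTheory in
/-- Hoeffding's lemma for a centred two-point distribution. -/
theorem bernoulli_mgf_le {p : ℝ} (h0 : 0 ≤ p) (h1 : p ≤ 1) (t : ℝ) :
    p * Real.exp (-(t * (1 - p))) + (1 - p) * Real.exp (t * p) ≤ Real.exp (t ^ 2 / 8) := by
  set μ : Measure ℝ := ENNReal.ofReal p • Measure.dirac (-(1 - p)) +
    ENNReal.ofReal (1 - p) • Measure.dirac p with hμ
  have hq : 0 ≤ 1 - p := by linarith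
  have integral_eq (f : ℝ → ℝ) : ∫ y, f y ∂μ = p * f (-(1 - p)) + (1 - p) * f p := by
    have hi (a c : ℝ) : Integrable f (ENNReal.ofReal c • Measure.dirac a) :=
      (integrable_dirac (by simp)).smul_measure (by simp)
    rw [hμ, integral_add_measure (hi _ _) (hi _ _), integral_smul_measure, integral_smul_measure]
    simp [ENNReal.toReal_ofReal, h0, h1]
  have : IsProbabilityMeasure μ := ⟨by
    simp [hμ, ← ENNReal.ofReal_add h0 hq]⟩
  have hmem : ∀ᵐ y ∂μ, id y ∈ Set.Icc (-(1 - p)) p := by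
    rw [hμ, ae_add_measure_iff]
    constructor <;> refine Measure.ae_smul_measure ?_ _ <;>
      rw [ae_dirac_eq, Filter.eventually_pure, id, Set.mem_Icc] <;> constructor <;> linarith
  have hmean : ∫ y, id y ∂μ = 0 := by
    rw [integral_eq]
    simp only [id]
    ring
  have h := (hasSubgaussianMGF_of_mem_Icc_of_integral_eq_zero aemeasurable_id hmem hmean).mgf_le t
  rw [mgf, integral_eq] at h
  have hexp : (((‖p - -(1 - p)‖₊ / 2) ^ 2 : NNReal) : ℝ) * t ^ 2 / 2 = t ^ 2 / 8 := by
    rw [show p - -(1 - p) = 1 by ring, nnnorm_one]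
    push_cast
    ring
  simpa only [hexp, id, mul_neg] using h

/-- Weight of `m` active sensors when each of `n` sensors fails with probability `p`. -/
noncomputable def activeWeight (n : ℕ) (p : ℝ) (m : ℕ) : ℝ :=
  n.choose m * (p ^ (n - m) * (1 - p) ^ m)

theorem activeWeight_nonneg {p : ℝ} (h0 : 0 ≤ p) (h1 : p ≤ 1) (n m : ℕ) :
    0 ≤ activeWeight n p m := by
  have : 0 ≤ 1 - p := by linarith
  unfold activeWeight
  positivity

theorem sum_activeWeight (n : ℕ) (p : ℝ) : ∑ m ∈ range (n + 1), activeWeight n p m = 1 := by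
  have h := add_pow (1 - p) p n
  rw [sub_add_cancel, one_pow] at h
  rw [h]
  refine sum_congr rfl fun m _ => ?_
  unfold activeWeight
  ring

theorem sum_activeWeight_mul_exp_le {p : ℝ} (h0 : 0 ≤ p) (h1 : p ≤ 1) (n : ℕ) (t : ℝ) :
    ∑ m ∈ range (n + 1), activeWeight n p m * Real.exp (t * (m - n * (1 - p))) ≤
      Real.exp (n * (t ^ 2 / 8)) := by
  have hq : 0 ≤ 1 - p := by linarith
  calc ∑ m ∈ range (n + 1), activeWeight n p m * Real.exp (t * (m - n * (1 - p)))
      = ((1 - p) * Real.exp (t * p) + p * Real.exp (-(t * (1 - p)))) ^ n := by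
        rw [add_pow]
        refine sum_congr rfl fun m hm => ?_
        have hmn : m ≤ n := Nat.lt_succ_iff.mp (mem_range.mp hm)
        have hexp : Real.exp (t * (m - n * (1 - p))) =
            Real.exp (t * p) ^ m * Real.exp (-(t * (1 - p))) ^ (n - m) := by
          rw [← Real.exp_nat_mul, ← Real.exp_nat_mul, ← Real.exp_add, Nat.cast_sub hmn]
          ring_nf
        rw [hexp, mul_pow, mul_pow, activeWeight]
        ring
    _ ≤ Real.exp (t ^ 2 / 8) ^ n := by
        gcongr
        rw [add_comm]
        exact bernoulli_mgf_le h0 h1 t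
    _ = _ := by rw [← Real.exp_nat_mul]

/-- Hoeffding's inequality for the number of active sensors; the sign of `δ` selects the tail. -/
theorem sum_activeWeight_tail_le {p : ℝ} (h0 : 0 ≤ p) (h1 : p ≤ 1) (n : ℕ) (δ : ℝ)
    (s : Finset ℕ) (hs : s ⊆ range (n + 1))
    (hδ : ∀ m ∈ s, n * δ ^ 2 ≤ δ * ((m : ℝ) - n * (1 - p))) :
    ∑ m ∈ s, activeWeight n p m ≤ Real.exp (-(2 * n * δ ^ 2)) := by
  have hw := activeWeight_nonneg h0 h1 n
  calc ∑ m ∈ s, activeWeight n p m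
      ≤ ∑ m ∈ s, activeWeight n p m * Real.exp (4 * δ * (m - n * (1 - p))) *
          Real.exp (-(4 * (n * δ ^ 2))) := by
        refine sum_le_sum fun m hm => ?_
        rw [mul_assoc, ← Real.exp_add]
        refine le_mul_of_one_le_right (hw m) (Real.one_le_exp ?_)
        linarith [hδ m hm]
    _ ≤ Real.exp (n * ((4 * δ) ^ 2 / 8)) * Real.exp (-(4 * (n * δ ^ 2))) := by
        rw [← sum_mul]
        gcongr
        refine le_trans (sum_le_sum_of_subset_of_nonneg hs fun m _ _ => ?_)
          (sum_activeWeight_mul_exp_le h0 h1 n (4 * δ))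
        exact mul_nonneg (hw m) (Real.exp_pos _).le
    _ = _ := by
        rw [← Real.exp_add]
        ring_nf

theorem cost0_nonneg {n : ℕ} (x : Fin n → ℝ) (A : Finset (Fin n)) : 0 ≤ cost0 x A := by
  unfold cost0
  split_ifs
  · exact Real.iSup_nonneg fun s => Real.iInf_nonneg fun j => abs_nonneg _
  · exact zero_le_one

theorem bddBelow_range_dist {n : ℕ} (x : Fin n → ℝ) (A : Finset (Fin n)) (s : ℝ) :
    BddBelow (Set.range fun j : A => |s - x j.1|) :=
  ⟨0, by rintro _ ⟨j, rfl⟩; exact abs_nonneg _⟩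

theorem iInf_dist_le_one {n : ℕ} {x : Fin n → ℝ} (hx : ∀ i, x i ∈ Set.Icc (0:ℝ) 1)
    {A : Finset (Fin n)} (hA : A.Nonempty) (s : Set.Icc (0:ℝ) 1) :
    ⨅ j : A, |s.1 - x j.1| ≤ 1 := by
  obtain ⟨j, hj⟩ := hA
  refine (ciInf_le (bddBelow_range_dist x A s.1) ⟨j, hj⟩).trans ?_
  exact abs_le.mpr ⟨by linarith [s.2.1, (hx j).2], by linarith [s.2.2, (hx j).1]⟩

theorem cost0_le_one {n : ℕ} {x : Fin n → ℝ} (hx : ∀ i, x i ∈ Set.Icc (0:ℝ) 1)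
    (A : Finset (Fin n)) : cost0 x A ≤ 1 := by
  unfold cost0
  split_ifs with hA
  · exact ciSup_le (iInf_dist_le_one hx hA)
  · exact le_rfl

theorem cost0_antitone {n : ℕ} {x : Fin n → ℝ} (hx : ∀ i, x i ∈ Set.Icc (0:ℝ) 1) :
    Antitone (cost0 x) := by
  intro A B hAB
  by_cases hA : A.Nonempty
  · have hB : B.Nonempty := hA.mono hAB
    have : Nonempty A := hA.to_subtype
    rw [cost0, cost0, if_pos hA, if_pos hB]
    refine ciSup_mono ⟨1, ?_⟩ fun s => le_ciInf fun j => ?_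
    · rintro _ ⟨s, rfl⟩
      exact iInf_dist_le_one hx hA s
    · exact ciInf_le (bddBelow_range_dist x B s.1) ⟨j.1, hAB j.2⟩
  · refine (cost0_le_one hx B).trans ?_
    rw [cost0, if_neg hA]

/-- Average of a set function over the subsets of cardinality `m`. -/
noncomputable def levelAverage {α : Type*} [Fintype α] (f : Finset α → ℝ) (m : ℕ) : ℝ :=
  ((Fintype.card α).choose m : ℝ)⁻¹ * ∑ A ∈ powersetCard m univ, f A

theorem succ_mul_sum_powersetCard_le {α : Type*} [Fintype α] {f : Finset α → ℝ}
    (hf : Antitone f) (m : ℕ) :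
    ((m + 1 : ℕ) : ℝ) * ∑ B ∈ powersetCard (m + 1) univ, f B ≤
      ((Fintype.card α - m : ℕ) : ℝ) * ∑ A ∈ powersetCard m univ, f A := by
  classical
  calc ((m + 1 : ℕ) : ℝ) * ∑ B ∈ powersetCard (m + 1) univ, f B
      = ∑ B ∈ powersetCard (m + 1) univ, ∑ _j ∈ B, f B := by
        rw [mul_sum]
        refine sum_congr rfl fun B hB => ?_
        rw [sum_const, (mem_powersetCard.mp hB).2, nsmul_eq_mul]
    _ ≤ ∑ B ∈ powersetCard (m + 1) univ, ∑ j ∈ B, f (B.erase j) :=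
        sum_le_sum fun B _ => sum_le_sum fun j _ => hf (erase_subset j B)
    _ = ∑ A ∈ powersetCard m univ, ∑ _j ∈ Aᶜ, f A := by
        rw [sum_sigma', sum_sigma']
        refine sum_bij' (fun z _ => ⟨z.1.erase z.2, z.2⟩) (fun z _ => ⟨insert z.2 z.1, z.2⟩)
          ?_ ?_ ?_ ?_ ?_ <;> rintro ⟨B, j⟩ h <;>
          simp only [mem_sigma, mem_powersetCard, subset_univ, true_and, mem_compl] at h ⊢
        · simp [card_erase_of_mem h.2, h.1]
        · simp [card_insert_of_notMem h.2, h.1]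
        · simp [insert_erase h.2]
        · simp [erase_insert h.2]
    _ = _ := by
        rw [mul_sum]
        refine sum_congr rfl fun A hA => ?_
        rw [sum_const, card_compl, (mem_powersetCard.mp hA).2, nsmul_eq_mul]

theorem levelAverage_succ_le {α : Type*} [Fintype α] {f : Finset α → ℝ} (hf : Antitone f)
    {m : ℕ} (hm : m + 1 ≤ Fintype.card α) : levelAverage f (m + 1) ≤ levelAverage f m := by
  have h := succ_mul_sum_powersetCard_le hf m
  have hc : ((Fintype.card α).choose (m + 1) : ℝ) * ((m + 1 : ℕ) : ℝ) =
      (Fintype.card α).choose m * ((Fintype.card α - m : ℕ) : ℝ) := by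
    exact_mod_cast Nat.choose_succ_right_eq (Fintype.card α) m
  have h1 : (0 : ℝ) < (Fintype.card α).choose (m + 1) := by exact_mod_cast Nat.choose_pos hm
  have h2 : (0 : ℝ) < (Fintype.card α).choose m := by exact_mod_cast Nat.choose_pos (by omega)
  have h3 : (0 : ℝ) < ((m + 1 : ℕ) : ℝ) := by positivity
  rw [levelAverage, levelAverage, inv_mul_le_iff₀ h1, ← mul_le_mul_iff_right₀ h3]
  refine h.trans_eq ?_
  rw [← mul_assoc, mul_comm ((m + 1 : ℕ) : ℝ), hc]
  field_simp

theorem levelAverage_le_of_le {α : Type*} [Fintype α] {f : Finset α → ℝ} (hf : Antitone f)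
    {a b : ℕ} (hab : a ≤ b) (hb : b ≤ Fintype.card α) : levelAverage f b ≤ levelAverage f a := by
  induction b, hab using Nat.le_induction with
  | base => exact le_rfl
  | succ m _ ih => exact (levelAverage_succ_le hf hb).trans (ih (by omega))

theorem levelAverage_nonneg {α : Type*} [Fintype α] {f : Finset α → ℝ} (hf : ∀ A, 0 ≤ f A)
    (m : ℕ) : 0 ≤ levelAverage f m :=
  mul_nonneg (by positivity) (sum_nonneg fun A _ => hf A)

theorem levelAverage_le_one {α : Type*} [Fintype α] {f : Finset α → ℝ} (hf : ∀ A, f A ≤ 1)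
    (m : ℕ) : levelAverage f m ≤ 1 := by
  refine inv_mul_le_one_of_le₀ ?_ (by positivity)
  refine (sum_le_sum fun A _ => hf A).trans_eq ?_
  simp

theorem cortesCost_eq_levelAverage {n k : ℕ} (hk : k ≤ n) (x : Fin n → ℝ) :
    cortesCost k x = levelAverage (cost0 x) (n - k) := by
  rw [cortesCost, levelAverage, Fintype.card_fin, Nat.choose_symm hk]
  congr 2
  ext A
  simp [mem_powersetCard]

theorem expCost_eq_sum_levelAverage {n : ℕ} (p : ℝ) (x : Fin n → ℝ) :
    expCost p x = ∑ m ∈ range (n + 1), activeWeight n p m * levelAverage (cost0 x) m := by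
  rw [expCost, ← powerset_univ, sum_powerset, card_univ, Fintype.card_fin]
  refine sum_congr rfl fun m hm => ?_
  have hc : (n.choose m : ℝ) ≠ 0 := by
    exact_mod_cast (Nat.choose_pos (Nat.lt_succ_iff.mp (mem_range.mp hm))).ne'
  rw [levelAverage, Fintype.card_fin, activeWeight, mul_comm (n.choose m : ℝ), mul_assoc,
    mul_inv_cancel_left₀ hc, mul_sum]
  refine sum_congr rfl fun A hA => ?_
  rw [prob, (mem_powersetCard.mp hA).2]

theorem expCost_le_levelAverage_add {n : ℕ} {p : ℝ} (h0 : 0 ≤ p) (h1 : p ≤ 1) {x : Fin n → ℝ}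
    (hx : ∀ i, x i ∈ Set.Icc (0:ℝ) 1) (r : ℕ) :
    expCost p x ≤ levelAverage (cost0 x) r +
      ∑ m ∈ range (n + 1) with m < r, activeWeight n p m := by
  have hw := activeWeight_nonneg h0 h1 n
  have ha := levelAverage_nonneg (cost0_nonneg x) r
  rw [expCost_eq_sum_levelAverage, ← one_mul (levelAverage _ r), ← sum_activeWeight n p, sum_mul,
    sum_filter, ← sum_add_distrib]
  refine sum_le_sum fun m hm => ?_
  split_ifs with h
  · have := mul_le_mul_of_nonneg_left (levelAverage_le_one (cost0_le_one hx) m) (hw m)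
    have := mul_nonneg (hw m) ha
    linarith
  · rw [add_zero]
    refine mul_le_mul_of_nonneg_left ?_ (hw m)
    refine levelAverage_le_of_le (cost0_antitone hx) (not_lt.mp h) ?_
    rw [Fintype.card_fin]
    exact Nat.lt_succ_iff.mp (mem_range.mp hm)

theorem levelAverage_le_expCost_add {n : ℕ} {p : ℝ} (h0 : 0 ≤ p) (h1 : p ≤ 1) {x : Fin n → ℝ}
    (hx : ∀ i, x i ∈ Set.Icc (0:ℝ) 1) {r : ℕ} (hr : r ≤ n) :
    levelAverage (cost0 x) r ≤ expCost p x +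
      ∑ m ∈ range (n + 1) with r < m, activeWeight n p m := by
  have hw := activeWeight_nonneg h0 h1 n
  rw [expCost_eq_sum_levelAverage, ← one_mul (levelAverage _ r), ← sum_activeWeight n p, sum_mul,
    sum_filter, ← sum_add_distrib]
  refine sum_le_sum fun m _ => ?_
  split_ifs with h
  · have := mul_le_mul_of_nonneg_left (levelAverage_le_one (cost0_le_one hx) r) (hw m)
    have := mul_nonneg (hw m) (levelAverage_nonneg (cost0_nonneg x) m)
    linarith
  · rw [add_zero]
    refine mul_le_mul_of_nonneg_left ?_ (hw m)
    exact levelAverage_le_of_le (cost0_antitone hx) (not_lt.mp h) (by rwa [Fintype.card_fin])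

/-- comparison of the Cortés model with the independent-failure
model: for `0 < k < n`, `0 < ε < min(k/n, 1 - k/n)` and any `x ∈ [0,1]^n`,
`C^{k/n-ε}(x) - e^{-2nε²} ≤ C^{k,n}(x) ≤ C^{k/n+ε}(x) + e^{-2nε²}`. -/
theorem cortes_vs_independent {n : ℕ} (k : ℕ) (hk0 : 0 < k) (hkn : k < n)
    (ε : ℝ) (hε0 : 0 < ε) (hε : ε < min ((k : ℝ) / n) (1 - (k : ℝ) / n))
    (x : Fin n → ℝ) (hx : ∀ i, x i ∈ Set.Icc (0:ℝ) 1) :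
    expCost ((k : ℝ) / n - ε) x - Real.exp (-(2 * n * ε ^ 2)) ≤ cortesCost k x ∧
    cortesCost k x ≤ expCost ((k : ℝ) / n + ε) x + Real.exp (-(2 * n * ε ^ 2)) := by
  obtain ⟨hεk, hεk'⟩ := lt_min_iff.mp hε
  have hn : (0 : ℝ) < n := by exact_mod_cast hk0.trans hkn
  have hnk : (n : ℝ) * (k / n) = k := mul_div_cancel₀ _ hn.ne'
  have hcast : ((n - k : ℕ) : ℝ) = n - k := Nat.cast_sub hkn.le
  rw [cortesCost_eq_levelAverage hkn.le]
  constructor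
  · have h0 : 0 ≤ (k : ℝ) / n - ε := by linarith
    have h1 : (k : ℝ) / n - ε ≤ 1 := by linarith
    have htail := sum_activeWeight_tail_le h0 h1 n (-ε)
      {m ∈ range (n + 1) | m < n - k} (filter_subset _ _) fun m hm => by
        have hm' : (m : ℝ) ≤ (n - k : ℕ) := by exact_mod_cast (mem_filter.mp hm).2.le
        rw [hcast] at hm'
        nlinarith
    rw [neg_sq] at htail
    linarith [expCost_le_levelAverage_add h0 h1 hx (n - k)]
  · have h0 : 0 ≤ (k : ℝ) / n + ε := by linarith
    have h1 : (k : ℝ) / n + ε ≤ 1 := by linarith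
    have htail := sum_activeWeight_tail_le h0 h1 n ε
      {m ∈ range (n + 1) | n - k < m} (filter_subset _ _) fun m hm => by
        have hm' : ((n - k : ℕ) : ℝ) ≤ m := by exact_mod_cast (mem_filter.mp hm).2.le
        rw [hcast] at hm'
        nlinarith
    linarith [levelAverage_le_expCost_add h0 h1 hx (Nat.sub_le n k)]
end

section
/- Let 0 < k < n. In the constant-number-of-failures model, the equispaced placement is nearly optimal: for every x ∈ [0,1]^n, C^{k,n}(x^eq) ≤ C^{k,n}(x) + (2/n) · k/(n−k). In particular, with x* an optimal placement for C^{k,n}, C^{k,n}(x^eq) ≤ C^{k,n}(x*) + (2/n) · k/(n−k). -/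
open Finset MeasureTheory

/-- The residue of an integer modulo `n`, as an element of `Fin n`. -/
def residue (n : ℕ) [NeZero n] (p : ℤ) : Fin n :=
  ⟨(p % n).toNat, by
    have hn : (0 : ℤ) < n := by exact_mod_cast NeZero.pos n
    have := Int.emod_nonneg p hn.ne'
    have := Int.emod_lt_of_pos p hn
    omega⟩

theorem coe_residue (n : ℕ) [NeZero n] (p : ℤ) : ((residue n p : ℕ) : ℤ) = p % n := by
  have hn : (n : ℤ) ≠ 0 := by exact_mod_cast NeZero.ne n
  exact Int.toNat_of_nonneg (Int.emod_nonneg p hn)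

theorem residue_add (n : ℕ) [NeZero n] (p q : ℤ) :
    residue n (p + q) = residue n p + residue n q := by
  apply Fin.ext
  zify
  rw [Fin.val_add, coe_residue]
  push_cast
  rw [coe_residue, coe_residue, ← Int.add_emod]

/-- No index strictly between `q` and `q + r`, taken modulo `n`, belongs to `A`. -/
def IsCyclicGap {n : ℕ} [NeZero n] (A : Finset (Fin n)) (q : ℤ) (r : ℕ) : Prop :=
  ∀ p : ℤ, q < p → p < q + r → residue n p ∉ A

theorem IsCyclicGap.map_addRight {n : ℕ} [NeZero n] {A : Finset (Fin n)} {q : ℤ} {r : ℕ}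
    (h : IsCyclicGap A q r) (t : ℤ) :
    IsCyclicGap (A.map (Equiv.addRight (residue n t)).toEmbedding) (q + t) r := by
  intro p hqp hpr hp
  obtain ⟨i, hi, hip⟩ := Finset.mem_map.1 hp
  have hres : residue n (p - t) = i := by
    have h1 := residue_add n (p - t) t
    rw [sub_add_cancel, ← hip] at h1
    exact (add_right_cancel h1).symm
  exact h (p - t) (by omega) (by omega) (hres ▸ hi)

theorem IsCyclicGap.le {n : ℕ} [NeZero n] {A : Finset (Fin n)} (hA : A.Nonempty) {q : ℤ} {r : ℕ}
    (h : IsCyclicGap A q r) : r ≤ n := by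
  by_contra! hr
  obtain ⟨j, hj⟩ := hA
  have hn : (0 : ℤ) < n := by exact_mod_cast NeZero.pos n
  have h0 := Int.emod_nonneg ((j : ℤ) - (q + 1)) hn.ne'
  have h1 := Int.emod_lt_of_pos ((j : ℤ) - (q + 1)) hn
  refine h (q + 1 + ((j : ℤ) - (q + 1)) % n) (by omega) (by omega) ?_
  have : residue n (q + 1 + ((j : ℤ) - (q + 1)) % n) = j := by
    apply Fin.ext
    zify
    rw [coe_residue, Int.add_emod_emod, add_sub_cancel]
    exact_mod_cast Nat.mod_eq_of_lt j.2
  rwa [this]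

/-- The lift of a placement on the circle to a placement on the line with
`cyclicLift x (q + n) = cyclicLift x q + 1`. -/
noncomputable def cyclicLift {n : ℕ} [NeZero n] (x : Fin n → ℝ) (q : ℤ) : ℝ :=
  x (residue n q) + ((q / n : ℤ) : ℝ)

theorem cyclicLift_add_period {n : ℕ} [NeZero n] (x : Fin n → ℝ) (q : ℤ) :
    cyclicLift x (q + n) = cyclicLift x q + 1 := by
  have hn : (n : ℤ) ≠ 0 := by exact_mod_cast NeZero.ne n
  have hres : residue n (q + n) = residue n q := by
    apply Fin.ext
    zify
    rw [coe_residue, coe_residue, Int.add_emod_right]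
  have hdiv : (q + n) / (n : ℤ) = q / n + 1 := by
    simpa using Int.add_mul_ediv_right q 1 hn
  simp only [cyclicLift, hres, hdiv]
  push_cast
  ring

theorem cyclicLift_monotone {n : ℕ} [NeZero n] {x : Fin n → ℝ} (hmono : Monotone x)
    (hx : ∀ i, x i ∈ Set.Icc (0 : ℝ) 1) : Monotone (cyclicLift x) := by
  intro p q hpq
  have hn : (0 : ℤ) < n := by exact_mod_cast NeZero.pos n
  have hdiv : p / (n : ℤ) ≤ q / n := Int.ediv_le_ediv hn hpq
  unfold cyclicLift
  rcases hdiv.eq_or_lt with heq | hlt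
  · have hle : residue n p ≤ residue n q := by
      rw [Fin.le_def]
      zify
      rw [coe_residue, coe_residue, Int.emod_def, Int.emod_def, heq]
      omega
    rw [heq]
    linarith [hmono hle]
  · have hcast : ((p / n : ℤ) : ℝ) + 1 ≤ ((q / n : ℤ) : ℝ) := by exact_mod_cast hlt
    linarith [(hx (residue n p)).2, (hx (residue n q)).1]

theorem sum_cyclicLift_sub {n : ℕ} [NeZero n] (x : Fin n → ℝ) (q : ℤ) (r : ℕ) :
    ∑ t ∈ Finset.range n, (cyclicLift x (q + t + r) - cyclicLift x (q + t)) = r := by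
  induction r with
  | zero => simp
  | succ r ih =>
    have hstep : ∑ t ∈ Finset.range n,
        (cyclicLift x (q + t + (r + 1 : ℕ)) - cyclicLift x (q + t + r)) = 1 := by
      have htel := Finset.sum_range_sub (fun t : ℕ => cyclicLift x (q + t + r)) n
      have hper := cyclicLift_add_period x (q + r)
      have hshift : q + (n : ℤ) + r = q + r + n := by ring
      simp only [Nat.cast_zero, add_zero, hshift, hper, add_sub_cancel_left] at htel
      rw [← htel]
      refine Finset.sum_congr rfl fun t _ => ?_
      congr 2
      push_cast
      ring
    calc _ = ∑ t ∈ Finset.range n,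
          ((cyclicLift x (q + t + r) - cyclicLift x (q + t)) +
            (cyclicLift x (q + t + (r + 1 : ℕ)) - cyclicLift x (q + t + r))) :=
          Finset.sum_congr rfl fun t _ => by ring
      _ = _ := by rw [Finset.sum_add_distrib, ih, hstep, Nat.cast_succ]

theorem le_cost0 {n : ℕ} {x : Fin n → ℝ} {A : Finset (Fin n)} (hA : A.Nonempty) {c s : ℝ}
    (hs : s ∈ Set.Icc (0 : ℝ) 1) (h : ∀ j ∈ A, c ≤ |s - x j|) : c ≤ cost0 x A := by
  rw [cost0, if_pos hA]
  obtain ⟨i, hi⟩ := hA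
  have : Nonempty A := ⟨⟨i, hi⟩⟩
  have hbdd : BddAbove (Set.range fun s : Set.Icc (0 : ℝ) 1 => ⨅ j : A, |s.1 - x j.1|) := by
    refine ⟨1 + |x i|, ?_⟩
    rintro _ ⟨u, rfl⟩
    refine (ciInf_le (Set.finite_range _).bddBelow (⟨i, hi⟩ : A)).trans ?_
    refine (abs_sub _ _).trans ?_
    rw [abs_of_nonneg u.2.1]
    linarith [u.2.2]
  exact (le_ciInf fun j : A => h j.1 j.2).trans (le_ciSup hbdd ⟨s, hs⟩)

theorem cost0_le {n : ℕ} {x : Fin n → ℝ} {A : Finset (Fin n)} (hA : A.Nonempty) {c : ℝ}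
    (h : ∀ s ∈ Set.Icc (0 : ℝ) 1, ∃ j ∈ A, |s - x j| ≤ c) : cost0 x A ≤ c := by
  rw [cost0, if_pos hA]
  refine ciSup_le fun s => ?_
  obtain ⟨j, hj, hjc⟩ := h s.1 s.2
  exact (ciInf_le (Set.finite_range _).bddBelow (⟨j, hj⟩ : A)).trans hjc

/-- A cyclic gap of the active set forces a coverage cost of at least half its length. -/
theorem IsCyclicGap.half_le_cost0 {n : ℕ} [NeZero n] {x : Fin n → ℝ} {σ : Equiv.Perm (Fin n)}
    (hmono : Monotone (x ∘ σ)) (hx : ∀ i, x i ∈ Set.Icc (0 : ℝ) 1) {A : Finset (Fin n)}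
    (hA : A.Nonempty) {q : ℤ} {r : ℕ} (h : IsCyclicGap A q r) :
    (cyclicLift (x ∘ σ) (q + r) - cyclicLift (x ∘ σ) q) / 2 ≤ cost0 x (A.map σ.toEmbedding) := by
  have hlift := cyclicLift_monotone hmono fun i => hx (σ i)
  set y := cyclicLift (x ∘ σ) with hy
  set m := (y q + y (q + r)) / 2 with hm
  refine le_cost0 hA.map ⟨Int.fract_nonneg m, (Int.fract_lt_one m).le⟩ fun i hi => ?_
  obtain ⟨j, hj, rfl⟩ := Finset.mem_map.1 hi
  have hn : (n : ℤ) ≠ 0 := by exact_mod_cast NeZero.ne n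
  have hres : residue n (j + ⌊m⌋ * n) = j := by
    apply Fin.ext
    zify
    rw [coe_residue, Int.add_mul_emod_self_right]
    exact_mod_cast Nat.mod_eq_of_lt j.2
  have hval : y (j + ⌊m⌋ * n) = x (σ j) + ⌊m⌋ := by
    have hdiv : ((j : ℕ) : ℤ) / (n : ℤ) = 0 := by exact_mod_cast Nat.div_eq_of_lt j.2
    rw [hy, cyclicLift, hres, Int.add_mul_ediv_right _ _ hn, hdiv, zero_add]
    rfl
  have hdiff : Int.fract m - x (σ j) = m - y (j + ⌊m⌋ * n) := by
    rw [hval, Int.fract]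
    ring
  change _ ≤ |Int.fract m - x (σ j)|
  rw [hdiff]
  rcases le_or_gt ((j : ℤ) + ⌊m⌋ * n) q with hle | hlt
  · refine le_trans ?_ (le_abs_self _)
    linarith [hlift hle]
  · rcases le_or_gt (q + r) ((j : ℤ) + ⌊m⌋ * n) with hle' | hlt'
    · refine le_trans ?_ (neg_le_abs _)
      linarith [hlift hle']
    · exact absurd (hres.symm ▸ hj) (h _ hlt hlt')

/-- The number of inactive sensors to the left and to the right of all active ones. -/
def boundaryRuns {n : ℕ} (A : Finset (Fin n)) : ℕ :=
  #{j | ∀ i ∈ A, j < i} + #{j | ∀ i ∈ A, i < j}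

/-- Up to the boundary runs, the cost of the equispaced placement is half the length of a cyclic
gap of the active set. -/
theorem exists_isCyclicGap_cost0_xeq_le {n : ℕ} [NeZero n] {A : Finset (Fin n)}
    (hA : A.Nonempty) : ∃ (q : ℤ) (r : ℕ), IsCyclicGap A q r ∧
      cost0 (xeq n) A ≤ r / (2 * n) + boundaryRuns A / (2 * n) := by
  classical
  obtain ⟨r, ⟨q, hq⟩, hmax⟩ : ∃ r : ℕ, (∃ q, IsCyclicGap A q r) ∧
      ∀ r' q', IsCyclicGap A q' r' → r' ≤ r := by
    have h0 : ∃ q, IsCyclicGap A q 0 := ⟨0, fun p hp hp' => by omega⟩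
    refine ⟨Nat.findGreatest (fun r => ∃ q, IsCyclicGap A q r) n,
      Nat.findGreatest_spec (P := fun r => ∃ q, IsCyclicGap A q r) (Nat.zero_le n) h0,
      fun r' q' h' => Nat.le_findGreatest (h'.le hA) ⟨q', h'⟩⟩
  refine ⟨q, r, hq, cost0_le hA fun s hs => ?_⟩
  have hn : (0 : ℝ) < n := by exact_mod_cast NeZero.pos n
  have hres : ∀ p : ℤ, 0 ≤ p → p < n → ((residue n p : ℕ) : ℤ) = p := fun p h0 h1 => by
    rw [coe_residue, Int.emod_eq_of_lt h0 h1]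
  rw [← add_div]
  by_cases hL : (A.filter fun j => xeq n j ≤ s).Nonempty
  · obtain ⟨i, hi, himax⟩ := Finset.exists_max_image _ (fun j => j) hL
    obtain ⟨hiA, his⟩ := Finset.mem_filter.1 hi
    by_cases hR : (A.filter fun j => s < xeq n j).Nonempty
    · obtain ⟨j, hj, hjmin⟩ := Finset.exists_min_image _ (fun j => j) hR
      obtain ⟨hjA, hjs⟩ := Finset.mem_filter.1 hj
      have hij : i < j := by
        have hlt := his.trans_lt hjs
        rw [xeq, xeq, div_lt_div_iff_of_pos_right (by positivity)] at hlt
        rw [Fin.lt_def]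
        have : ((i : ℕ) : ℝ) < (j : ℕ) := by linarith
        exact_mod_cast this
      have hgap : IsCyclicGap A (i : ℕ) ((j : ℕ) - (i : ℕ)) := by
        intro p hp hp' hpA
        have hpn : p < n := by have := j.2; omega
        have hval := hres p (by omega) hpn
        rcases le_or_gt (xeq n (residue n p)) s with hle | hlt
        · have := himax _ (Finset.mem_filter.2 ⟨hpA, hle⟩)
          rw [Fin.le_def] at this
          omega
        · have := hjmin _ (Finset.mem_filter.2 ⟨hpA, hlt⟩)
          rw [Fin.le_def] at this
          omega
      have hr := hmax _ _ hgap
      have hr' : ((j : ℕ) : ℝ) ≤ r + (i : ℕ) := by exact_mod_cast (by omega : (j : ℕ) ≤ r + i)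
      have hsum : xeq n j - xeq n i ≤ 2 * ((r + boundaryRuns A : ℝ) / (2 * n)) := by
        rw [xeq, xeq, ← sub_div, mul_div_assoc', div_le_div_iff_of_pos_right (by positivity)]
        have : (0 : ℝ) ≤ boundaryRuns A := Nat.cast_nonneg _
        linarith
      rcases le_or_gt (s - xeq n i) ((r + boundaryRuns A : ℝ) / (2 * n)) with hle | hlt
      · exact ⟨i, hiA, by rwa [abs_of_nonneg (by linarith)]⟩
      · exact ⟨j, hjA, by rw [abs_of_neg (by linarith)]; linarith⟩
    · have hall : ∀ j ∈ A, j ≤ i := fun j hj => himax j <| Finset.mem_filter.2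
        ⟨hj, not_lt.1 fun hlt => hR ⟨j, Finset.mem_filter.2 ⟨hj, hlt⟩⟩⟩
      have hruns : n - 1 - (i : ℕ) ≤ boundaryRuns A := by
        rw [← Fin.card_Ioi]
        refine (Finset.card_le_card fun j hj => ?_).trans (Nat.le_add_left _ _)
        exact Finset.mem_filter.2
          ⟨Finset.mem_univ _, fun l hl => (hall l hl).trans_lt (Finset.mem_Ioi.1 hj)⟩
      have hgap : IsCyclicGap A (i : ℕ) (n - (i : ℕ)) := by
        intro p hp hp' hpA
        have hval := hres p (by omega) (by have := i.2; omega)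
        have := Fin.le_def.1 (hall _ hpA)
        omega
      have hr := hmax _ _ hgap
      refine ⟨i, hiA, ?_⟩
      have hi2 := i.2
      have hkey : (2 * n : ℝ) ≤ r + boundaryRuns A + 1 + 2 * (i : ℕ) := by
        exact_mod_cast (by omega : 2 * n ≤ r + boundaryRuns A + 1 + 2 * (i : ℕ))
      rw [abs_of_nonneg (by linarith), xeq, sub_le_iff_le_add, ← add_div,
        le_div_iff₀ (by positivity)]
      nlinarith [hs.2]
  · have hall : ∀ j ∈ A, s < xeq n j := fun j hj =>
      not_le.1 fun hle => hL ⟨j, Finset.mem_filter.2 ⟨hj, hle⟩⟩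
    obtain ⟨i, hiA, himin⟩ := Finset.exists_min_image A (fun j => j) hA
    have hruns : (i : ℕ) ≤ boundaryRuns A := by
      rw [← Fin.card_Iio]
      refine (Finset.card_le_card fun j hj => ?_).trans (Nat.le_add_right _ _)
      exact Finset.mem_filter.2
        ⟨Finset.mem_univ _, fun l hl => (Finset.mem_Iio.1 hj).trans_le (himin l hl)⟩
    have hgap : IsCyclicGap A (-1) ((i : ℕ) + 1) := by
      intro p hp hp' hpA
      have hval := hres p (by omega) (by have := i.2; omega)
      have := Fin.le_def.1 (himin _ hpA)
      omega
    have hr := hmax _ _ hgap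
    refine ⟨i, hiA, ?_⟩
    have hkey : 2 * ((i : ℕ) : ℝ) + 1 ≤ r + boundaryRuns A := by
      exact_mod_cast (by omega : 2 * (i : ℕ) + 1 ≤ r + boundaryRuns A)
    have hle : xeq n i ≤ (r + boundaryRuns A : ℝ) / (2 * n) :=
      div_le_div_of_nonneg_right hkey (by positivity)
    rw [abs_of_neg (by linarith [hall i hiA])]
    linarith [hs.1]

/-- Adding to each `m`-set an element related to all its members produces each `(m + 1)`-set at
most once. -/
theorem sum_card_forall_rel_le {n : ℕ} (m : ℕ) (R : Fin n → Fin n → Prop) [DecidableRel R]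
    (hR : ∀ i j, R i j → ¬ R j i) :
    ∑ A : Finset (Fin n) with A.card = m, #{j | ∀ i ∈ A, R j i} ≤ n.choose (m + 1) := by
  have hirr : ∀ i, ¬ R i i := fun i h => hR i i h h
  rw [← Finset.card_sigma]
  have hcard : #(Finset.powersetCard (m + 1) (Finset.univ : Finset (Fin n))) = n.choose (m + 1) := by
    simp
  rw [← hcard]
  refine Finset.card_le_card_of_injOn (fun P => insert P.2 P.1) ?_ ?_
  · rintro ⟨A, j⟩ hP
    simp only [Finset.coe_sigma, Set.mem_sigma_iff, Finset.mem_coe, Finset.mem_filter,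
      Finset.mem_univ, true_and] at hP
    simp only [Finset.mem_coe, Finset.mem_powersetCard, Finset.subset_univ, true_and]
    rw [Finset.card_insert_of_notMem fun hj => hirr j (hP.2 j hj), hP.1]
  · rintro ⟨A, j⟩ hP ⟨B, l⟩ hQ hPQ
    simp only [Finset.coe_sigma, Set.mem_sigma_iff, Finset.mem_coe, Finset.mem_filter,
      Finset.mem_univ, true_and] at hP hQ
    dsimp only at hPQ
    have hjA : j ∉ A := fun h => hirr j (hP.2 j h)
    have hlB : l ∉ B := fun h => hirr l (hQ.2 l h)
    have hjl : j = l := by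
      by_contra hne
      have hj : j ∈ insert l B := hPQ ▸ Finset.mem_insert_self j A
      have hl : l ∈ insert j A := hPQ ▸ Finset.mem_insert_self l B
      exact hR _ _ (hP.2 l (Finset.mem_of_mem_insert_of_ne hl (Ne.symm hne)))
        (hQ.2 j (Finset.mem_of_mem_insert_of_ne hj hne))
    subst hjl
    have hAB : A = B := by
      rw [← Finset.erase_insert hjA, hPQ, Finset.erase_insert hlB]
    rw [hAB]

theorem sum_boundaryRuns_le (n m : ℕ) :
    ∑ A : Finset (Fin n) with A.card = m, boundaryRuns A ≤ 2 * n.choose (m + 1) := by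
  simp only [boundaryRuns, Finset.sum_add_distrib, two_mul]
  exact add_le_add (sum_card_forall_rel_le m (· < ·) fun _ _ h => h.asymm)
    (sum_card_forall_rel_le m (· > ·) fun _ _ h => h.asymm)

theorem sum_card_eq_map_equiv {n : ℕ} (m : ℕ) (f : Finset (Fin n) → ℝ) (e : Equiv.Perm (Fin n)) :
    ∑ A : Finset (Fin n) with A.card = m, f (A.map e.toEmbedding) =
      ∑ A : Finset (Fin n) with A.card = m, f A :=
  Finset.sum_equiv e.finsetCongr (by simp) (by simp)

/-- Averaging over rotations: the total cost dominates half the normalized total length of any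
choice of cyclic gaps. -/
theorem sum_gap_le_sum_cost0 {n m : ℕ} [NeZero n] (hm : 0 < m) {x : Fin n → ℝ}
    (hx : ∀ i, x i ∈ Set.Icc (0 : ℝ) 1) {q : Finset (Fin n) → ℤ} {r : Finset (Fin n) → ℕ}
    (h : ∀ A : Finset (Fin n), A.Nonempty → IsCyclicGap A (q A) (r A)) :
    ∑ A : Finset (Fin n) with A.card = m, (r A : ℝ) / (2 * n) ≤
      ∑ A : Finset (Fin n) with A.card = m, cost0 x A := by
  have hn : (0 : ℝ) < n := by exact_mod_cast NeZero.pos n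
  set σ := Tuple.sort x
  have hmono : Monotone (x ∘ σ) := Tuple.monotone_sort x
  have hrot : ∀ t : ℕ, ∑ A : Finset (Fin n) with A.card = m,
      (cyclicLift (x ∘ σ) (q A + t + r A) - cyclicLift (x ∘ σ) (q A + t)) / 2 ≤
      ∑ A : Finset (Fin n) with A.card = m, cost0 x A := by
    intro t
    rw [← sum_card_eq_map_equiv m (cost0 x) σ,
      ← sum_card_eq_map_equiv m (fun A => cost0 x (A.map σ.toEmbedding))
        (Equiv.addRight (residue n t))]
    refine Finset.sum_le_sum fun A hA => ?_
    have hne : A.Nonempty := Finset.card_pos.1 (by rw [(Finset.mem_filter.1 hA).2]; exact hm)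
    exact ((h A hne).map_addRight t).half_le_cost0 hmono hx hne.map
  have htotal := Finset.sum_le_sum fun t (_ : t ∈ Finset.range n) => hrot t
  rw [Finset.sum_comm, Finset.sum_const, Finset.card_range, nsmul_eq_mul] at htotal
  simp only [← Finset.sum_div, sum_cyclicLift_sub] at htotal
  rw [← Finset.sum_div, div_le_iff₀ (by positivity)]
  linarith

/-- near-optimality of the equispaced placement in the Cortés
model: `C^{k,n}(x^eq) ≤ C^{k,n}(x) + (2/n)·k/(n-k)` for every `x ∈ [0,1]^n`. -/
theorem cortes_xeq_near_optimal {n : ℕ} (k : ℕ) (hk0 : 0 < k) (hkn : k < n)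
    (x : Fin n → ℝ) (hx : ∀ i, x i ∈ Set.Icc (0:ℝ) 1) :
    cortesCost k (xeq n) ≤ cortesCost k x + 2 / n * ((k : ℝ) / ((n : ℝ) - k)) := by
  have : NeZero n := ⟨by omega⟩
  have hn : (0 : ℝ) < n := by exact_mod_cast NeZero.pos n
  have hm : 0 < n - k := by omega
  have hex : ∀ A : Finset (Fin n), ∃ (q : ℤ) (r : ℕ), A.Nonempty → IsCyclicGap A q r ∧
      cost0 (xeq n) A ≤ r / (2 * n) + boundaryRuns A / (2 * n) := by
    intro A
    by_cases hA : A.Nonempty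
    · obtain ⟨q, r, h⟩ := exists_isCyclicGap_cost0_xeq_le hA
      exact ⟨q, r, fun _ => h⟩
    · exact ⟨0, 0, fun h => absurd h hA⟩
  choose q r hqr using hex
  have hgap := sum_gap_le_sum_cost0 hm hx fun A hA => (hqr A hA).1
  have hruns : (∑ A : Finset (Fin n) with A.card = n - k, (boundaryRuns A : ℝ)) ≤
      2 * n.choose (n - k + 1) := by
    exact_mod_cast sum_boundaryRuns_le n (n - k)
  have hsum : ∑ A : Finset (Fin n) with A.card = n - k, cost0 (xeq n) A ≤
      (∑ A : Finset (Fin n) with A.card = n - k, cost0 x A) + n.choose (n - k + 1) / n := by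
    have hle : ∑ A : Finset (Fin n) with A.card = n - k, cost0 (xeq n) A ≤
        ∑ A : Finset (Fin n) with A.card = n - k,
          ((r A : ℝ) / (2 * n) + boundaryRuns A / (2 * n)) :=
      Finset.sum_le_sum fun A hA => (hqr A (Finset.card_pos.1 (by
        rw [(Finset.mem_filter.1 hA).2]; exact hm))).2
    rw [Finset.sum_add_distrib, ← Finset.sum_div _ (fun A => (boundaryRuns A : ℝ))] at hle
    refine hle.trans (add_le_add hgap ?_)
    rw [div_le_div_iff₀ (by positivity) hn]
    nlinarith
  have hchoose : (0 : ℝ) < n.choose k := by exact_mod_cast Nat.choose_pos hkn.le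
  have hsub : (0 : ℝ) < (n : ℝ) - k := sub_pos.2 (by exact_mod_cast hkn)
  have hratio : (n.choose (n - k + 1) : ℝ) * (n - k + 1) = n.choose k * k := by
    have h1 := Nat.choose_succ_right_eq n (n - k)
    rw [Nat.choose_symm hkn.le, Nat.sub_sub_self hkn.le] at h1
    have h2 : ((n.choose (n - k + 1) * (n - k + 1) : ℕ) : ℝ) = (n.choose k * k : ℕ) := by rw [h1]
    push_cast [Nat.cast_sub hkn.le] at h2
    exact h2
  have hbound : (n.choose k : ℝ)⁻¹ * (n.choose (n - k + 1) / n) ≤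
      2 / n * ((k : ℝ) / ((n : ℝ) - k)) := by
    have hc : (0 : ℝ) ≤ n.choose (n - k + 1) := Nat.cast_nonneg _
    have hk : (0 : ℝ) ≤ n.choose k * k := by positivity
    rw [inv_mul_eq_div, div_div, div_mul_div_comm, div_le_div_iff₀ (by positivity) (by positivity)]
    have : (n.choose (n - k + 1) : ℝ) * (n - k) ≤ 2 * (n.choose k * k) := by linarith
    nlinarith
  unfold cortesCost
  calc _ ≤ (n.choose k : ℝ)⁻¹ * ((∑ A : Finset (Fin n) with A.card = n - k, cost0 x A) +
        n.choose (n - k + 1) / n) := mul_le_mul_of_nonneg_left hsum (by positivity)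
    _ ≤ _ := by
      rw [mul_add]
      linarith
end

section
/- Let 0 < k < n and set m = n − k ≥ 2. In the constant-number-of-failures model with the random placement, H_{m+1}/(2(m+1)) ≤ E[C^{k,n}(x^rand)] ≤ (H_{m−1} + 4)/(2(m+1)). Consequently E[C^{k,n}(x^rand)] = (log m)/(2m) + O(1/m) as m → ∞. -/
open Finset MeasureTheory

/-- The `m + 1` successive gaps of the sequence `0, y 0, …, y (m - 1), L`. -/
noncomputable def gap {m : ℕ} (L : ℝ) (y : Fin m → ℝ) (i : Fin (m + 1)) : ℝ :=
  (Fin.snoc y L : Fin (m + 1) → ℝ) i - (Fin.cons 0 y : Fin (m + 1) → ℝ) i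

/-- The strictly increasing `m`-tuples with entries in the open interval `(0, L)`. -/
def orderedSimplex (m : ℕ) (L : ℝ) : Set (Fin m → ℝ) := {y | ∀ i, 0 < gap L y i}

lemma sum_gap {m : ℕ} (L : ℝ) (y : Fin m → ℝ) : ∑ i, gap L y i = L := by
  unfold gap
  rw [Finset.sum_sub_distrib, Fin.sum_univ_castSucc, Fin.sum_univ_succ]
  simp

lemma continuous_gap {m : ℕ} (L : ℝ) (i : Fin (m + 1)) :
    Continuous fun y : Fin m → ℝ => gap L y i := by
  unfold gap
  refine Continuous.sub ?_ ?_
  · induction i using Fin.lastCases with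
    | last => simpa using continuous_const
    | cast j => simpa using continuous_apply j
  · induction i using Fin.cases with
    | zero => simpa using continuous_const
    | succ j => simpa using continuous_apply j

lemma isOpen_orderedSimplex (m : ℕ) (L : ℝ) : IsOpen (orderedSimplex m L) := by
  simp only [orderedSimplex, Set.ofPred_forall]
  exact isOpen_iInter_of_finite fun i => isOpen_lt continuous_const (continuous_gap L i)

lemma gap_smul {m : ℕ} (r L : ℝ) (y : Fin m → ℝ) (i : Fin (m + 1)) :
    gap (r * L) (r • y) i = r * gap L y i := by
  unfold gap
  rw [mul_sub]
  congr 1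
  · induction i using Fin.lastCases <;> simp
  · induction i using Fin.cases <;> simp

/-- Enlarging the gaps by `w` amounts to a translation of the tuple. -/
lemma gap_add {m : ℕ} (L : ℝ) (w : Fin (m + 1) → ℝ) (y : Fin m → ℝ) (i : Fin (m + 1)) :
    gap L (y + fun j => ∑ k ∈ Finset.Iic j.castSucc, w k) i = gap (L - ∑ k, w k) y i + w i := by
  have hright : (Fin.snoc (y + fun j => ∑ k ∈ Finset.Iic j.castSucc, w k) L : Fin (m + 1) → ℝ) i
      = (Fin.snoc y (L - ∑ k, w k) : Fin (m + 1) → ℝ) i + ∑ k ∈ Finset.Iic i, w k := by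
    induction i using Fin.lastCases with
    | last =>
      have : Finset.Iic (Fin.last m) = Finset.univ := by ext; simp [Fin.le_last]
      simp [this]
    | cast j => simp
  have hleft : (Fin.cons 0 (y + fun j => ∑ k ∈ Finset.Iic j.castSucc, w k) : Fin (m + 1) → ℝ) i
      = (Fin.cons 0 y : Fin (m + 1) → ℝ) i + ∑ k ∈ Finset.Iio i, w k := by
    induction i using Fin.cases with
    | zero =>
      have : Finset.Iio (0 : Fin (m + 1)) = ∅ := by ext; simp
      simp [this]
    | succ j =>
      have : Finset.Iio j.succ = Finset.Iic j.castSucc := by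
        ext k; simp [Fin.lt_def, Fin.le_def]
      simp [this]
  have hsum : ∑ k ∈ Finset.Iic i, w k = ∑ k ∈ Finset.Iio i, w k + w i := by
    rw [← Finset.Iio_insert, Finset.sum_insert (by simp), add_comm]
  unfold gap
  rw [hright, hleft, hsum]
  ring

open scoped Pointwise in
lemma volume_orderedSimplex {m : ℕ} (hm : m ≠ 0) (L : ℝ) :
    volume.real (orderedSimplex m L) = max 0 L ^ m * volume.real (orderedSimplex m 1) := by
  rcases le_or_gt L 0 with hL | hL
  · have hempty : orderedSimplex m L = ∅ := by
      refine Set.eq_empty_of_forall_notMem fun y hy => ?_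
      have := Finset.sum_pos (fun i _ => hy i) Finset.univ_nonempty
      rw [sum_gap] at this
      linarith
    rw [hempty, max_eq_left hL, zero_pow hm]
    simp
  · have hscale : orderedSimplex m L = L • orderedSimplex m 1 := by
      ext y
      rw [Set.mem_smul_set_iff_inv_smul_mem₀ hL.ne']
      refine forall_congr' fun i => ?_
      have := gap_smul L 1 (L⁻¹ • y) i
      rw [smul_inv_smul₀ hL.ne', mul_one] at this
      rw [this, mul_pos_iff_of_pos_left hL]
    rw [hscale, measureReal_def, Measure.addHaar_smul, ENNReal.toReal_mul, measureReal_def,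
      ENNReal.toReal_ofReal (abs_nonneg _), max_eq_right hL.le, abs_of_nonneg (by positivity)]
    simp

/-- Volume of the set of ordered tuples whose gaps indexed by `T` all exceed `t`. -/
lemma volume_gaps_gt {m : ℕ} (hm : m ≠ 0) (T : Finset (Fin (m + 1))) {t : ℝ} (ht : 0 ≤ t) :
    (volume.restrict (orderedSimplex m 1)).real (⋂ i ∈ T, {y | t < gap 1 y i})
      = max 0 (1 - #T * t) ^ m * volume.real (orderedSimplex m 1) := by
  have hmeas : MeasurableSet (⋂ i ∈ T, {y : Fin m → ℝ | t < gap 1 y i}) :=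
    T.measurableSet_biInter fun i _ =>
      (isOpen_lt continuous_const (continuous_gap 1 i)).measurableSet
  set w : Fin (m + 1) → ℝ := fun i => if i ∈ T then t else 0 with hw
  have hsum : ∑ k, w k = #T * t := by simp [hw]
  have hset : (⋂ i ∈ T, {y : Fin m → ℝ | t < gap 1 y i}) ∩ orderedSimplex m 1
      = {y | ∀ i, w i < gap 1 y i} := by
    ext y
    simp only [orderedSimplex, Set.mem_inter_iff, Set.mem_iInter, Set.mem_ofPred_eq, hw]
    constructor
    · rintro ⟨h₁, h₂⟩ i
      split_ifs with hi
      exacts [h₁ i hi, h₂ i]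
    · intro h
      refine ⟨fun i hi => by simpa [hi] using h i, fun i => lt_of_le_of_lt ?_ (h i)⟩
      split_ifs <;> simp [ht]
  rw [measureReal_restrict_apply hmeas, hset, ← volume_orderedSimplex hm, measureReal_def,
    measureReal_def, ← measure_preimage_add_right volume
      (fun j : Fin m => ∑ k ∈ Finset.Iic j.castSucc, w k)]
  congr 2
  ext y
  simp [orderedSimplex, gap_add, hsum]

lemma integral_max_one_sub_mul_pow {k m : ℕ} (hk : k ≠ 0) (hm : m ≠ 0) :
    ∫ t in (0 : ℝ)..1, max 0 (1 - k * t) ^ m = 1 / (k * (m + 1)) := by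
  have hk0 : (0 : ℝ) < k := by positivity
  have hk1 : (1 : ℝ) / k ≤ 1 := by
    rw [div_le_one hk0]; exact_mod_cast Nat.one_le_iff_ne_zero.mpr hk
  have hint (a b : ℝ) : IntervalIntegrable (fun t : ℝ => max 0 (1 - k * t) ^ m) volume a b :=
    (by fun_prop : Continuous fun t : ℝ => max 0 (1 - k * t) ^ m).intervalIntegrable a b
  have hfirst : ∫ t in (0 : ℝ)..(1 / k), max 0 (1 - k * t) ^ m
      = ∫ t in (0 : ℝ)..(1 / k), (1 - k * t) ^ m := by
    refine intervalIntegral.integral_congr fun t ht => ?_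
    rw [Set.uIcc_of_le (by positivity)] at ht
    have : k * t ≤ 1 := by
      have := ht.2
      rwa [le_div_iff₀' hk0] at this
    rw [max_eq_right (by linarith)]
  have hsecond : ∫ t in (1 / k : ℝ)..1, max 0 (1 - k * t) ^ m = 0 := by
    rw [intervalIntegral.integral_congr (g := fun _ => (0 : ℝ)), intervalIntegral.integral_zero]
    intro t ht
    rw [Set.uIcc_of_le hk1] at ht
    have : 1 ≤ k * t := by
      have := ht.1
      rwa [div_le_iff₀' hk0] at this
    simp only
    rw [max_eq_left (by linarith), zero_pow hm]
  rw [← intervalIntegral.integral_add_adjacent_intervals (hint 0 (1 / k)) (hint _ _), hfirst,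
    hsecond, intervalIntegral.integral_comp_sub_mul (fun u => u ^ m) hk0.ne', integral_pow]
  simp [hk0.ne']
  ring

lemma H_succ (s : ℕ) : H (s + 1) = H s + 1 / ((s : ℝ) + 1) := Finset.sum_range_succ _ _

lemma sum_range_alternating_choose_div (s : ℕ) :
    ∑ k ∈ Finset.range (s + 1), (s.choose k : ℝ) * ((-1) ^ (k + 1) * (1 / k)) = H s := by
  have halt (s : ℕ) : ∑ k ∈ Finset.range (s + 1), (s.choose k : ℝ) * ((-1) ^ k * (1 / (k + 1)))
      = 1 / (s + 1) := by
    have hz : ∑ k ∈ Finset.range (s + 2), ((-1 : ℝ) ^ k * ((s + 1).choose k : ℝ)) = 0 := by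
      have := Int.alternating_sum_range_choose_of_ne (n := s + 1) (by simp)
      exact_mod_cast this
    rw [Finset.sum_range_succ'] at hz
    have hterm (k : ℕ) : (s.choose k : ℝ) * ((-1) ^ k * (1 / (k + 1)))
        = -(1 / (s + 1)) * ((-1 : ℝ) ^ (k + 1) * ((s + 1).choose (k + 1) : ℝ)) := by
      have h : ((s : ℝ) + 1) * s.choose k = (s + 1).choose (k + 1) * (k + 1) := by
        exact_mod_cast Nat.add_one_mul_choose_eq s k
      field_simp
      rw [pow_succ]
      linear_combination (-1) ^ k * h
    rw [Finset.sum_congr rfl fun k _ => hterm k, ← Finset.mul_sum]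
    simp at hz
    rw [eq_neg_of_add_eq_zero_left hz]
    ring
  induction s with
  | zero => simp [H]
  | succ s ih =>
    have hshift : ∑ k ∈ Finset.range (s + 1), (s.choose k : ℝ) * ((-1) ^ (k + 1) * (1 / k))
        = ∑ k ∈ Finset.range (s + 1),
            (s.choose (k + 1) : ℝ) * ((-1) ^ (k + 1 + 1) * (1 / ((k + 1 : ℕ) : ℝ))) := by
      rw [Finset.sum_range_succ', Finset.sum_range_succ _ s]
      simp
    rw [H_succ, ← ih, hshift, ← halt s, Finset.sum_range_succ', ← Finset.sum_add_distrib]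
    simp only [Nat.cast_zero, div_zero, mul_zero, add_zero]
    refine Finset.sum_congr rfl fun k _ => ?_
    rw [Nat.choose_succ_succ]
    push_cast
    ring

lemma sum_powerset_alternating_div {α : Type*} (S : Finset α) :
    ∑ T ∈ S.powerset with T.Nonempty, (-1 : ℝ) ^ (#T + 1) * (1 / #T) = H #S := by
  rw [Finset.sum_filter_of_ne, Finset.sum_powerset_apply_card fun k => (-1 : ℝ) ^ (k + 1) * (1 / k)]
  · simpa using sum_range_alternating_choose_div #S
  · intro T _ hT
    rw [Finset.nonempty_iff_ne_empty]
    rintro rfl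
    simp at hT

lemma gap_le_one {m : ℕ} {y : Fin m → ℝ} (hy : y ∈ orderedSimplex m 1) (i : Fin (m + 1)) :
    gap 1 y i ≤ 1 := by
  conv_rhs => rw [← sum_gap 1 y]
  exact Finset.single_le_sum (fun j _ => (hy j).le) (Finset.mem_univ i)

lemma mem_orderedSimplex_one_iff {m : ℕ} {y : Fin m → ℝ} :
    y ∈ orderedSimplex m 1 ↔ StrictMono y ∧ ∀ j, y j ∈ Set.Ioo (0 : ℝ) 1 := by
  cases m with
  | zero =>
    refine ⟨fun _ => ⟨fun i => i.elim0, fun i => i.elim0⟩, fun _ i => ?_⟩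
    have := sum_gap 1 y
    rw [Fin.sum_univ_one] at this
    rw [Fin.fin_one_eq_zero i, this]
    exact one_pos
  | succ m =>
    have hgap : y ∈ orderedSimplex (m + 1) 1 ↔
        0 < y 0 ∧ (∀ j : Fin m, y j.castSucc < y j.succ) ∧ y (Fin.last m) < 1 := by
      have hzero : gap 1 y 0 = y 0 := by
        rw [gap, Fin.cons_zero, sub_zero]
        exact Fin.snoc_castSucc (α := fun _ => ℝ) 1 y 0
      have hmid (j : Fin m) : gap 1 y j.castSucc.succ = y j.succ - y j.castSucc := by
        rw [gap, Fin.cons_succ, Fin.succ_castSucc, Fin.snoc_castSucc]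
      have hlast : gap 1 y (Fin.last m).succ = 1 - y (Fin.last m) := by
        rw [gap, Fin.cons_succ, Fin.succ_last, Fin.snoc_last]
      simp only [orderedSimplex, Set.mem_ofPred_eq, Fin.forall_fin_succ (n := m + 1),
        Fin.forall_fin_succ' (n := m), hzero, hmid, hlast, sub_pos]
    rw [hgap, Fin.strictMono_iff_lt_succ]
    refine ⟨fun ⟨h₀, hmono, h₁⟩ => ⟨hmono, fun j => ?_⟩,
      fun ⟨hmono, h⟩ => ⟨(h 0).1, hmono, (h _).2⟩⟩
    have := (Fin.strictMono_iff_lt_succ.mpr hmono).monotone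
    exact ⟨h₀.trans_le (this (Fin.zero_le j)), (this (Fin.le_last j)).trans_lt h₁⟩

/-- The unit cube. -/
def unitCube (m : ℕ) : Set (Fin m → ℝ) := Set.univ.pi fun _ => Set.Icc 0 1

lemma volume_unitCube (m : ℕ) : volume (unitCube m) = 1 := by
  rw [unitCube, volume_pi_pi]
  simp

lemma orderedSimplex_subset_unitCube (m : ℕ) : orderedSimplex m 1 ⊆ unitCube m :=
  fun _ hy j _ => Set.Ioo_subset_Icc_self ((mem_orderedSimplex_one_iff.mp hy).2 j)

lemma volume_orderedSimplex_ne_top (m : ℕ) : volume (orderedSimplex m 1) ≠ ⊤ :=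
  measure_ne_top_of_subset (orderedSimplex_subset_unitCube m) (by simp [volume_unitCube])

lemma continuous_sup'_gap {m : ℕ} (S : Finset (Fin (m + 1))) (hS : S.Nonempty) :
    Continuous fun y : Fin m → ℝ => S.sup' hS (gap 1 y) :=
  Continuous.finset_sup'_apply hS fun i _ => continuous_gap 1 i

lemma integrableOn_sup'_gap {m : ℕ} (S : Finset (Fin (m + 1))) (hS : S.Nonempty) :
    IntegrableOn (fun y : Fin m → ℝ => S.sup' hS (gap 1 y)) (orderedSimplex m 1) := by
  refine Measure.integrableOn_of_bounded (M := 1) (volume_orderedSimplex_ne_top m)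
    (continuous_sup'_gap S hS).aestronglyMeasurable ?_
  filter_upwards [ae_restrict_mem (isOpen_orderedSimplex m 1).measurableSet] with y hy
  obtain ⟨i, hi⟩ := hS
  rw [Real.norm_eq_abs, abs_of_nonneg ((hy i).le.trans (Finset.le_sup' (gap 1 y) hi))]
  exact Finset.sup'_le _ _ fun i _ => gap_le_one hy i

/-- The mean over the ordered tuples of the largest of `s` given gaps is `H s / (m + 1)`. -/
lemma integral_sup'_gap {m : ℕ} (hm : m ≠ 0) (S : Finset (Fin (m + 1))) (hS : S.Nonempty) :
    ∫ y in orderedSimplex m 1, S.sup' hS (gap 1 y)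
      = H #S / (m + 1) * volume.real (orderedSimplex m 1) := by
  have hΩ := (isOpen_orderedSimplex m 1).measurableSet
  have : IsFiniteMeasure (volume.restrict (orderedSimplex m 1)) :=
    isFiniteMeasure_restrict.mpr (volume_orderedSimplex_ne_top m)
  have hnonneg : 0 ≤ᵐ[volume.restrict (orderedSimplex m 1)]
      fun y : Fin m → ℝ => S.sup' hS (gap 1 y) := by
    filter_upwards [ae_restrict_mem hΩ] with y hy
    obtain ⟨i, hi⟩ := hS
    exact (hy i).le.trans (Finset.le_sup' (gap 1 y) hi)
  have htail {t : ℝ} (ht : 0 ≤ t) :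
      (volume.restrict (orderedSimplex m 1)).real {y | t < S.sup' hS (gap 1 y)}
        = ∑ T ∈ S.powerset with T.Nonempty, (-1 : ℝ) ^ (#T + 1) *
          (max 0 (1 - #T * t) ^ m * volume.real (orderedSimplex m 1)) := by
    have hset : {y : Fin m → ℝ | t < S.sup' hS (gap 1 y)} = ⋃ i ∈ S, {y | t < gap 1 y i} := by
      ext y; simp [Finset.lt_sup'_iff]
    rw [hset, measureReal_biUnion_eq_sum_powerset fun i _ =>
      (isOpen_lt continuous_const (continuous_gap 1 i)).measurableSet]
    exact Finset.sum_congr rfl fun T _ => by rw [volume_gaps_gt hm T ht]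
  rw [(integrableOn_sup'_gap S hS).integral_eq_integral_meas_lt hnonneg,
    setIntegral_congr_fun measurableSet_Ioi fun t (ht : 0 < t) => htail ht.le,
    setIntegral_eq_of_subset_of_forall_sdiff_eq_zero measurableSet_Ioi Set.Ioc_subset_Ioi_self
      (s := Set.Ioc (0 : ℝ) 1), ← intervalIntegral.integral_of_le zero_le_one,
    intervalIntegral.integral_finsetSum]
  · rw [← sum_powerset_alternating_div, Finset.sum_div, Finset.sum_mul]
    refine Finset.sum_congr rfl fun T hT => ?_
    have hT0 : #T ≠ 0 := (Finset.card_pos.mpr (Finset.mem_filter.mp hT).2).ne'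
    rw [intervalIntegral.integral_const_mul, intervalIntegral.integral_mul_const,
      integral_max_one_sub_mul_pow hT0 hm]
    field_simp
  · exact fun T _ => Continuous.intervalIntegrable (by fun_prop) _ _
  · rintro t ⟨ht0, ht1⟩
    have ht : 1 < t := by
      by_contra! h
      exact ht1 ⟨ht0, h⟩
    refine Finset.sum_eq_zero fun T hT => ?_
    have hT0 : (1 : ℝ) ≤ #T := by
      exact_mod_cast Finset.card_pos.mpr (Finset.mem_filter.mp hT).2
    rw [max_eq_left (by nlinarith), zero_pow hm, zero_mul, mul_zero]

lemma measurePreserving_comp_of_injective {ι κ : Type*} [Fintype ι] [Fintype κ] (ν : Measure ℝ)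
    [IsProbabilityMeasure ν] {e : ι → κ} (he : Function.Injective e) :
    MeasurePreserving (fun x : κ → ℝ => x ∘ e) (Measure.pi fun _ => ν)
      (Measure.pi fun _ => ν) := by
  have hmeas : Measurable fun x : κ → ℝ => x ∘ e :=
    measurable_pi_lambda _ fun i => measurable_pi_apply (e i)
  refine ⟨hmeas, (Measure.pi_eq fun s hs => ?_).symm⟩
  have hpre : (fun x : κ → ℝ => x ∘ e) ⁻¹' Set.univ.pi s
      = Set.univ.pi (Function.extend e s fun _ => Set.univ) := by
    ext x
    simp only [Set.mem_preimage, Set.mem_univ_pi, Function.comp_apply]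
    refine ⟨fun h k => ?_, fun h i => by simpa [he.extend_apply] using h (e i)⟩
    by_cases hk : ∃ i, e i = k
    · obtain ⟨i, rfl⟩ := hk
      simpa [he.extend_apply] using h i
    · simp [Function.extend_apply' _ _ _ hk]
  rw [Measure.map_apply hmeas (MeasurableSet.univ_pi hs), hpre, Measure.pi_pi]
  refine (Fintype.prod_of_injective e he _ _ (fun k hk => ?_) fun i => ?_).symm
  · rw [Function.extend_apply' _ _ _ hk, measure_univ]
  · rw [he.extend_apply]

lemma volume_restrict_unitCube (m : ℕ) :
    (volume.restrict (unitCube m) : Measure (Fin m → ℝ))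
      = Measure.pi fun _ => volume.restrict (Set.Icc (0 : ℝ) 1) := by
  rw [unitCube, volume_pi, Measure.restrict_pi_pi]

lemma measurePreserving_comp_unitCube {m n : ℕ} (e : Fin m ↪ Fin n) :
    MeasurePreserving (fun x : Fin n → ℝ => x ∘ e) (volume.restrict (unitCube n))
      (volume.restrict (unitCube m)) := by
  have : IsProbabilityMeasure (volume.restrict (Set.Icc (0 : ℝ) 1)) := ⟨by simp⟩
  rw [volume_restrict_unitCube, volume_restrict_unitCube]
  exact measurePreserving_comp_of_injective _ e.injective

lemma ae_injective (m : ℕ) : ∀ᵐ x : Fin m → ℝ, Function.Injective x := by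
  have hne (i j : Fin m) (hij : i ≠ j) : ∀ᵐ x : Fin m → ℝ, x i ≠ x j := by
    let V : Submodule ℝ (Fin m → ℝ) :=
      LinearMap.ker (LinearMap.proj (R := ℝ) (φ := fun _ => ℝ) i - LinearMap.proj j)
    have hV : V ≠ ⊤ := by
      intro h
      have : (Pi.single i 1 : Fin m → ℝ) ∈ V := h ▸ Submodule.mem_top
      simp [V, hij] at this
    refine measure_mono_null (fun x hx => ?_) (Measure.addHaar_submodule volume V hV)
    simpa [V, sub_eq_zero] using hx
  have : ∀ᵐ x : Fin m → ℝ, ∀ i j, i ≠ j → x i ≠ x j := by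
    simp only [ae_all_iff]
    exact hne
  filter_upwards [this] with x hx i j hij
  by_contra h
  exact hx i j h hij

/-- Up to a null set, the unit cube is the union of the regions on which the order of the
coordinates is prescribed. -/
lemma unitCube_ae_eq_iUnion (m : ℕ) :
    (unitCube m : Set (Fin m → ℝ)) =ᵐ[volume]
      ⋃ σ : Equiv.Perm (Fin m), {x | x ∘ σ ∈ orderedSimplex m 1} := by
  have hIoo : (Set.univ.pi fun _ : Fin m => Set.Ioo (0 : ℝ) 1) =ᵐ[volume] unitCube m :=
    Measure.pi_Ioo_ae_eq_pi_Icc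
  refine hIoo.symm.trans ?_
  rw [Filter.eventuallyEq_set]
  filter_upwards [ae_injective m] with x hx
  simp only [Set.mem_iUnion, Set.mem_univ_pi, Set.mem_ofPred_eq, mem_orderedSimplex_one_iff,
    Function.comp_apply]
  constructor
  · intro h
    exact ⟨Tuple.sort x, (Tuple.monotone_sort x).strictMono_of_injective
      (hx.comp (Equiv.injective _)), fun j => h _⟩
  · rintro ⟨σ, -, h⟩ i
    simpa using h (σ.symm i)

/-- The integral over the unit cube of a function invariant under permutations of the coordinates
is `m !` times its integral over the ordered tuples. -/
lemma setIntegral_unitCube_of_symmetric {m : ℕ} {f : (Fin m → ℝ) → ℝ}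
    (hf : IntegrableOn f (unitCube m)) (hsymm : ∀ (σ : Equiv.Perm (Fin m)) x, f (x ∘ σ) = f x) :
    ∫ x in unitCube m, f x = m.factorial * ∫ x in orderedSimplex m 1, f x := by
  have hopen (σ : Equiv.Perm (Fin m)) : IsOpen {x : Fin m → ℝ | x ∘ σ ∈ orderedSimplex m 1} :=
    (isOpen_orderedSimplex m 1).preimage (continuous_pi fun i => continuous_apply (σ i))
  have hpiece (σ : Equiv.Perm (Fin m)) :
      ∫ x in {x | x ∘ σ ∈ orderedSimplex m 1}, f x = ∫ x in orderedSimplex m 1, f x := by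
    have hmp := volume_measurePreserving_piCongrLeft (fun _ : Fin m => ℝ) σ.symm
    have hcomp (x : Fin m → ℝ) : MeasurableEquiv.piCongrLeft (fun _ => ℝ) σ.symm x = x ∘ σ := by
      ext i
      rw [MeasurableEquiv.coe_piCongrLeft, Equiv.piCongrLeft_apply]
      simp
    rw [← hmp.setIntegral_preimage_emb (MeasurableEquiv.measurableEmbedding _) f
      (orderedSimplex m 1)]
    simp only [hcomp, hsymm, Set.preimage]
  rw [setIntegral_congr_set (unitCube_ae_eq_iUnion m), integral_iUnion_fintype]
  · simp [hpiece, Fintype.card_perm]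
  · exact fun σ => (hopen σ).measurableSet
  · intro σ τ hστ
    refine Set.disjoint_left.mpr fun x hσ hτ => hστ ?_
    have hxσ := (mem_orderedSimplex_one_iff.mp hσ).1
    have hxτ := (mem_orderedSimplex_one_iff.mp hτ).1
    have heq := Tuple.unique_monotone hxσ.monotone hxτ.monotone
    have hinj : Function.Injective x := by
      have := hxσ.injective.comp σ.symm.injective
      simpa [Function.comp_assoc] using this
    exact Equiv.ext fun i => hinj (congrFun heq i)
  · intro σ
    refine hf.mono_set fun x hx i _ => ?_
    have := (mem_orderedSimplex_one_iff.mp hx).2 (σ.symm i)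
    exact Set.Ioo_subset_Icc_self (by simpa using this)

lemma factorial_mul_volume_orderedSimplex (m : ℕ) :
    m.factorial * volume.real (orderedSimplex m 1) = 1 := by
  have := setIntegral_unitCube_of_symmetric (m := m) (f := fun _ => 1)
    (by simp [IntegrableOn, isFiniteMeasure_restrict, volume_unitCube]) (by simp)
  simpa [measureReal_def, volume_unitCube] using this.symm

/-- The largest distance from a point of `[0,1]` to the family `x`. -/
noncomputable def coverRadius {ι : Type*} (x : ι → ℝ) : ℝ :=
  ⨆ s : Set.Icc (0 : ℝ) 1, ⨅ j, |s.1 - x j|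

lemma coverRadius_comp_equiv {ι κ : Type*} (e : ι ≃ κ) (x : κ → ℝ) :
    coverRadius (x ∘ e) = coverRadius x :=
  congrArg iSup <| funext fun s => e.iInf_comp (g := fun j => |s.1 - x j|)

lemma bddBelow_range_abs_sub {ι : Type*} (x : ι → ℝ) (s : ℝ) :
    BddBelow (Set.range fun j => |s - x j|) :=
  ⟨0, by rintro _ ⟨j, rfl⟩; positivity⟩

lemma bddAbove_range_iInf_abs_sub {ι : Type*} [Nonempty ι] (x : ι → ℝ) :
    BddAbove (Set.range fun s : Set.Icc (0 : ℝ) 1 => ⨅ j, |s.1 - x j|) := by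
  obtain ⟨j⟩ := ‹Nonempty ι›
  refine ⟨1 + |x j|, ?_⟩
  rintro _ ⟨s, rfl⟩
  refine (ciInf_le (bddBelow_range_abs_sub x s) j).trans ((abs_sub _ _).trans ?_)
  rw [abs_of_nonneg s.2.1]
  linarith [s.2.2]

lemma lipschitzWith_coverRadius {ι : Type*} [Fintype ι] [Nonempty ι] :
    LipschitzWith 1 (coverRadius : (ι → ℝ) → ℝ) := by
  refine LipschitzWith.of_le_add fun x y => ciSup_le fun s => ?_
  have hxy : (⨅ j, |s.1 - x j|) - dist x y ≤ ⨅ j, |s.1 - y j| := by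
    refine le_ciInf fun j => ?_
    have h₁ := ciInf_le (bddBelow_range_abs_sub x s) j
    have h₂ := abs_sub_le s.1 (y j) (x j)
    have h₃ := dist_le_pi_dist x y j
    rw [Real.dist_eq, abs_sub_comm] at h₃
    linarith
  have := le_ciSup (bddAbove_range_iInf_abs_sub y) s
  unfold coverRadius
  linarith

lemma integrableOn_coverRadius {m : ℕ} (hm : m ≠ 0) :
    IntegrableOn (coverRadius : (Fin m → ℝ) → ℝ) (unitCube m) := by
  have : NeZero m := ⟨hm⟩
  exact lipschitzWith_coverRadius.continuous.continuousOn.integrableOn_compact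
    (isCompact_univ_pi fun _ => isCompact_Icc)

lemma le_cons_of_castSucc_lt {m : ℕ} {y : Fin m → ℝ} (hy : Monotone y) {i : Fin (m + 1)}
    {j : Fin m} (hij : j.castSucc < i) : y j ≤ (Fin.cons 0 y : Fin (m + 1) → ℝ) i := by
  induction i using Fin.cases with
  | zero => exact absurd hij (Fin.not_lt_zero _)
  | succ k =>
    rw [Fin.cons_succ]
    exact hy (Fin.castSucc_lt_succ_iff.mp hij)

lemma snoc_le_of_le_castSucc {m : ℕ} {y : Fin m → ℝ} (hy : Monotone y) {i : Fin (m + 1)}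
    {j : Fin m} (hij : i ≤ j.castSucc) (L : ℝ) : (Fin.snoc y L : Fin (m + 1) → ℝ) i ≤ y j := by
  induction i using Fin.lastCases with
  | last => exact absurd (Fin.castSucc_lt_last j) (not_lt.mpr hij)
  | cast k =>
    rw [Fin.snoc_castSucc]
    exact hy (Fin.castSucc_le_castSucc_iff.mp hij)

lemma gap_div_two_le_coverRadius {m : ℕ} (hm : m ≠ 0) {y : Fin m → ℝ}
    (hy : y ∈ orderedSimplex m 1) (i : Fin (m + 1)) : gap 1 y i / 2 ≤ coverRadius y := by
  have : NeZero m := ⟨hm⟩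
  obtain ⟨hmono, hmem⟩ := mem_orderedSimplex_one_iff.mp hy
  have hi : 0 < gap 1 y i := hy i
  set a := (Fin.cons 0 y : Fin (m + 1) → ℝ) i with ha
  set b := (Fin.snoc y 1 : Fin (m + 1) → ℝ) i with hb
  have hgap : gap 1 y i = b - a := rfl
  have ha0 : 0 ≤ a := by
    rw [ha]
    induction i using Fin.cases with
    | zero => simp
    | succ k => simpa using (hmem k).1.le
  have hb1 : b ≤ 1 := by
    rw [hb]
    induction i using Fin.lastCases with
    | last => simp
    | cast k => simpa using (hmem k).2.le
  refine le_ciSup_of_le (bddAbove_range_iInf_abs_sub y)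
    ⟨(a + b) / 2, by linarith, by linarith⟩ (le_ciInf fun j => ?_)
  rcases lt_or_ge j.castSucc i with hij | hij
  · have := le_cons_of_castSucc_lt hmono.monotone hij
    exact le_abs.mpr (Or.inl (by simp only; linarith))
  · have := snoc_le_of_le_castSucc hmono.monotone hij 1
    exact le_abs.mpr (Or.inr (by simp only; linarith))

/-- The indices of the gaps between two consecutive entries of the tuple. -/
def innerGaps (m : ℕ) : Finset (Fin (m + 1)) := Finset.univ \ {0, Fin.last m}

lemma card_innerGaps {m : ℕ} (hm : m ≠ 0) : #(innerGaps m) = m - 1 := by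
  rw [innerGaps, Finset.card_sdiff_of_subset (Finset.subset_univ _), Finset.card_pair]
  · simp
  · rw [Ne, Fin.ext_iff]
    simpa using hm.symm

lemma innerGaps_nonempty {m : ℕ} (hm : 2 ≤ m) : (innerGaps m).Nonempty := by
  rw [← Finset.card_pos, card_innerGaps (by omega)]
  omega

lemma exists_mem_gap {m : ℕ} (y : Fin m → ℝ) {s : ℝ} (hs : s ∈ Set.Icc (0 : ℝ) 1) :
    ∃ i : Fin (m + 1), (Fin.cons 0 y : Fin (m + 1) → ℝ) i ≤ s ∧
      s ≤ (Fin.snoc y 1 : Fin (m + 1) → ℝ) i := by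
  obtain ⟨i, hi, hmin⟩ := WellFounded.has_min (wellFounded_lt (α := Fin (m + 1)))
    {i | s ≤ (Fin.snoc y 1 : Fin (m + 1) → ℝ) i} ⟨Fin.last m, by simpa using hs.2⟩
  refine ⟨i, ?_, hi⟩
  induction i using Fin.cases with
  | zero => simpa using hs.1
  | succ k =>
    by_contra! h
    exact hmin k.castSucc (by simpa using h.le) Fin.castSucc_lt_succ

lemma coverRadius_le {m : ℕ} (hm : 2 ≤ m) {y : Fin m → ℝ} (hy : y ∈ orderedSimplex m 1) :
    coverRadius y ≤ gap 1 y 0 + gap 1 y (Fin.last m)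
      + (innerGaps m).sup' (innerGaps_nonempty hm) (gap 1 y) / 2 := by
  refine ciSup_le fun ⟨s, hs⟩ => ?_
  have h0 := hy 0
  have hlast := hy (Fin.last m)
  have hsup : 0 < (innerGaps m).sup' (innerGaps_nonempty hm) (gap 1 y) := by
    obtain ⟨i, hi⟩ := innerGaps_nonempty hm
    exact (hy i).trans_le (Finset.le_sup' (gap 1 y) hi)
  have hle (j : Fin m) := ciInf_le (bddBelow_range_abs_sub y s) j
  obtain ⟨i, hleft, hright⟩ := exists_mem_gap y hs
  by_cases hi0 : i = 0
  · obtain ⟨j, hj⟩ : ∃ j : Fin m, i = j.castSucc := ⟨⟨0, by omega⟩, by ext; simp [hi0]⟩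
    have hgap : gap 1 y 0 = y j := by
      rw [← hi0, gap, hj, Fin.snoc_castSucc, ← hj, hi0, Fin.cons_zero, sub_zero]
    rw [hj, Fin.snoc_castSucc] at hright
    refine (hle j).trans ?_
    rw [abs_sub_comm, abs_of_nonneg (by linarith)]
    linarith [hs.1]
  by_cases hil : i = Fin.last m
  · obtain ⟨j, hj⟩ := Fin.exists_succ_eq.mpr hi0
    have hgap : gap 1 y (Fin.last m) = 1 - y j := by
      rw [gap, Fin.snoc_last, ← hil, ← hj, Fin.cons_succ]
    rw [← hj, Fin.cons_succ] at hleft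
    refine (hle j).trans ?_
    rw [abs_of_nonneg (by linarith)]
    linarith [hs.2]
  have hsup' : gap 1 y i ≤ (innerGaps m).sup' (innerGaps_nonempty hm) (gap 1 y) :=
    Finset.le_sup' (gap 1 y) (by simp [innerGaps, hi0, hil])
  obtain ⟨j, hj⟩ := Fin.exists_succ_eq.mpr hi0
  obtain ⟨k, hk⟩ := Fin.exists_castSucc_eq.mpr hil
  have hgap : gap 1 y i = y k - y j := by
    rw [gap]
    congr 1
    · rw [← hk, Fin.snoc_castSucc]
    · rw [← hj, Fin.cons_succ]
  rw [← hj, Fin.cons_succ] at hleft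
  rw [← hk, Fin.snoc_castSucc] at hright
  have h₁ := hle j
  have h₂ := hle k
  rw [abs_of_nonneg (by linarith)] at h₁
  rw [abs_sub_comm, abs_of_nonneg (by linarith)] at h₂
  linarith

lemma integral_coverRadius (m : ℕ) (hm : m ≠ 0) :
    ∫ x in unitCube m, coverRadius x = m.factorial * ∫ y in orderedSimplex m 1, coverRadius y :=
  setIntegral_unitCube_of_symmetric (integrableOn_coverRadius hm)
    fun σ x => coverRadius_comp_equiv σ x

lemma le_integral_coverRadius {m : ℕ} (hm : m ≠ 0) :
    H (m + 1) / (2 * ((m : ℝ) + 1)) ≤ ∫ x in unitCube m, coverRadius x := by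
  have hΩ := (isOpen_orderedSimplex m 1).measurableSet
  have hle := setIntegral_mono_on
    ((integrableOn_sup'_gap Finset.univ Finset.univ_nonempty).div_const 2)
    ((integrableOn_coverRadius hm).mono_set (orderedSimplex_subset_unitCube m)) hΩ
    fun y hy => (show Finset.univ.sup' Finset.univ_nonempty (gap 1 y) / 2 ≤ coverRadius y by
      rw [div_le_iff₀ two_pos]
      exact Finset.sup'_le _ _ fun i _ => by linarith [gap_div_two_le_coverRadius hm hy i])
  rw [integral_div, integral_sup'_gap hm, Finset.card_univ, Fintype.card_fin] at hle
  rw [integral_coverRadius m hm]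
  refine le_trans (le_of_eq ?_) (mul_le_mul_of_nonneg_left hle (Nat.cast_nonneg _))
  have := factorial_mul_volume_orderedSimplex m
  have hm1 : (m : ℝ) + 1 ≠ 0 := by positivity
  field_simp
  linear_combination -H (m + 1) * this

lemma integral_coverRadius_le {m : ℕ} (hm : 2 ≤ m) :
    ∫ x in unitCube m, coverRadius x ≤ (H (m - 1) + 4) / (2 * ((m : ℝ) + 1)) := by
  have hm0 : m ≠ 0 := by omega
  have hΩ := (isOpen_orderedSimplex m 1).measurableSet
  have hsingle (i : Fin (m + 1)) : IntegrableOn (fun y => gap 1 y i) (orderedSimplex m 1) := by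
    simpa using integrableOn_sup'_gap {i} (Finset.singleton_nonempty i)
  have hmean (i : Fin (m + 1)) : ∫ y in orderedSimplex m 1, gap 1 y i
      = 1 / (m + 1) * volume.real (orderedSimplex m 1) := by
    simpa [H] using integral_sup'_gap hm0 {i} (Finset.singleton_nonempty i)
  have hends : IntegrableOn (fun y => gap 1 y 0 + gap 1 y (Fin.last m)) (orderedSimplex m 1) :=
    (hsingle 0).add (hsingle (Fin.last m))
  have hinner := (integrableOn_sup'_gap _ (innerGaps_nonempty hm)).div_const 2
  have hle := setIntegral_mono_on
    ((integrableOn_coverRadius hm0).mono_set (orderedSimplex_subset_unitCube m))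
    (hends.add hinner) hΩ
    fun y hy => coverRadius_le hm hy
  rw [integral_add' hends hinner,
    integral_add (hsingle 0) (hsingle (Fin.last m)), integral_div, integral_sup'_gap hm0,
    hmean, hmean, card_innerGaps hm0] at hle
  rw [integral_coverRadius m hm0]
  refine (mul_le_mul_of_nonneg_left hle (Nat.cast_nonneg _)).trans (le_of_eq ?_)
  have := factorial_mul_volume_orderedSimplex m
  have hm1 : (m : ℝ) + 1 ≠ 0 := by positivity
  field_simp
  linear_combination (H (m - 1) + 4) * this

lemma cost0_eq_coverRadius {n m : ℕ} (hm : m ≠ 0) (x : Fin n → ℝ) {A : Finset (Fin n)}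
    (hA : #A = m) : cost0 x A = coverRadius (x ∘ A.orderEmbOfFin hA) := by
  have hne : A.Nonempty := Finset.card_pos.mp (by omega)
  rw [cost0, if_pos hne]
  exact (coverRadius_comp_equiv (A.orderIsoOfFin hA).toEquiv fun j : A => x j).symm

lemma randCortes_eq_integral_coverRadius {n k : ℕ} (hkn : k < n) :
    randCortes n k = ∫ x in unitCube (n - k), coverRadius x := by
  have hm : n - k ≠ 0 := by omega
  have : NeZero (n - k) := ⟨hm⟩
  have hmp {A : Finset (Fin n)} (hA : #A = n - k) :=
    measurePreserving_comp_unitCube (A.orderEmbOfFin hA).toEmbedding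
  have hint (A : Finset (Fin n)) (hA : #A = n - k) :
      IntegrableOn (fun x => cost0 x A) (unitCube n) := by
    simp only [cost0_eq_coverRadius hm _ hA]
    exact (hmp hA).integrable_comp_of_integrable (integrableOn_coverRadius hm)
  have hval (A : Finset (Fin n)) (hA : #A = n - k) :
      ∫ x in unitCube n, cost0 x A = ∫ x in unitCube (n - k), coverRadius x := by
    simp only [cost0_eq_coverRadius hm _ hA]
    rw [← (hmp hA).map_eq, integral_map (hmp hA).measurable.aemeasurable
      lipschitzWith_coverRadius.continuous.aestronglyMeasurable]
    rfl
  have hcard : #{A : Finset (Fin n) | #A = n - k} = n.choose k := by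
    have hfilter : ({A : Finset (Fin n) | #A = n - k} : Finset (Finset (Fin n)))
        = Finset.univ.powersetCard (n - k) := by
      ext A
      simp
    rw [hfilter, Finset.card_powersetCard, Finset.card_univ, Fintype.card_fin,
      Nat.choose_symm hkn.le]
  change ∫ x in unitCube n, cortesCost k x = _
  unfold cortesCost
  rw [integral_const_mul, integral_finsetSum _ fun A hA => hint A (Finset.mem_filter.mp hA).2,
    Finset.sum_congr rfl fun A hA => hval A (Finset.mem_filter.mp hA).2, Finset.sum_const, hcard,
    nsmul_eq_mul, inv_mul_cancel_left₀]
  exact_mod_cast (Nat.choose_pos hkn.le).ne'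

lemma H_eq_harmonic (m : ℕ) : H m = (harmonic m : ℝ) := by
  simp [H, harmonic]

/-- in the Cortés model with random placement and `m = n - k ≥ 2`
active sensors, `H_{m+1}/(2(m+1)) ≤ E[C^{k,n}(x^rand)] ≤ (H_{m-1}+4)/(2(m+1))`;
consequently `E[C^{k,n}(x^rand)] = (log m)/(2m) + O(1/m)` as `m → ∞`. -/
theorem randCortes_bounds :
    (∀ n k : ℕ, 0 < k → k < n → 2 ≤ n - k →
      H (n - k + 1) / (2 * (((n - k : ℕ) : ℝ) + 1)) ≤ randCortes n k ∧
      randCortes n k ≤ (H (n - k - 1) + 4) / (2 * (((n - k : ℕ) : ℝ) + 1))) ∧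
    ∃ M : ℝ, 0 < M ∧ ∃ m0 : ℕ, ∀ n k : ℕ, 0 < k → k < n → m0 ≤ n - k →
      |randCortes n k - Real.log ((n - k : ℕ) : ℝ) / (2 * ((n - k : ℕ) : ℝ))|
        ≤ M / ((n - k : ℕ) : ℝ) := by
  have hbounds (n k : ℕ) (hkn : k < n) (hm : 2 ≤ n - k) :
      H (n - k + 1) / (2 * (((n - k : ℕ) : ℝ) + 1)) ≤ randCortes n k ∧
      randCortes n k ≤ (H (n - k - 1) + 4) / (2 * (((n - k : ℕ) : ℝ) + 1)) := by
    rw [randCortes_eq_integral_coverRadius hkn]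
    exact ⟨le_integral_coverRadius (by omega), integral_coverRadius_le hm⟩
  refine ⟨fun n k _ => hbounds n k, 5 / 2, by norm_num, 2, fun n k _ hkn hm => ?_⟩
  obtain ⟨hlo, hhi⟩ := hbounds n k hkn hm
  generalize n - k = m at *
  have hm0 : (0 : ℝ) < m := by positivity
  have hlog : 0 ≤ Real.log m := Real.log_natCast_nonneg m
  have hlog' : Real.log m ≤ m := (Real.log_le_sub_one_of_pos hm0).trans (by linarith)
  have hHlo : Real.log m ≤ H (m + 1) := by
    rw [H_eq_harmonic]
    refine le_trans (Real.log_le_log hm0 ?_) (log_add_one_le_harmonic (m + 1))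
    push_cast
    linarith
  have hHhi : H (m - 1) ≤ 1 + Real.log m := by
    rw [H_eq_harmonic]
    refine (harmonic_le_one_add_log (m - 1)).trans ?_
    gcongr
    · exact_mod_cast (by omega : 0 < m - 1)
    · omega
  rw [abs_le]
  constructor
  · have : Real.log m / (2 * m) - 5 / 2 / m ≤ H (m + 1) / (2 * ((m : ℝ) + 1)) := by
      calc Real.log m / (2 * m) - 5 / 2 / m = (Real.log m - 5) / (2 * m) := by field_simp
        _ ≤ Real.log m / (2 * (m + 1)) := by
          rw [div_le_div_iff₀ (by positivity) (by positivity)]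
          nlinarith
        _ ≤ _ := by gcongr
    linarith
  · have : (H (m - 1) + 4) / (2 * ((m : ℝ) + 1)) ≤ Real.log m / (2 * m) + 5 / 2 / m := by
      calc (H (m - 1) + 4) / (2 * ((m : ℝ) + 1)) ≤ (Real.log m + 5) / (2 * (m + 1)) :=
            div_le_div_of_nonneg_right (by linarith) (by positivity)
        _ ≤ (Real.log m + 5) / (2 * m) := by
          gcongr
          linarith
        _ = _ := by field_simp
    linarith
end
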